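/- arXiv:1712.04866 — 2 statements merged into one kernel-verified Lean document; each statement's English description precedes it below -/
import Mathlib

section
/- Let 1 ≤ k ≤ n−1 and let f : Λ^{k+1} × Λ^{k−1} → ℝ be ext-int. one convex (resp. ext-int. one affine). Then for every fixed ξ ∈ Λ^{k+1}, the function f^ξ : Λ^{k−1} → ℝ defined by f^ξ(η) := f(ξ,η) is int. one convex (resp. int. one affine). -/
/-! Basic setup: `Λᵏ(ℝⁿ)` in coordinates with respect to the standard basis
`e^I`, `I` a strictly increasing multi-index (modeled as a `k`-element subset of
`Fin n`), together with the exterior product, interior product, inner product,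
Hodge star, and the various notions of one-directional convexity/affinity. -/

/-- Increasing multi-indices of length `k` in `{1,…,n}`: `k`-element subsets of `Fin n`.
`Idx n k` plays the role of `T_k`. -/
abbrev Idx (n k : ℕ) := {s : Finset (Fin n) // s.card = k}

/-- `Λᵏ(ℝⁿ)`, identified with its coordinates in the standard basis `e^I`. -/
abbrev Lam (n k : ℕ) := Idx n k → ℝ

/-- The sign `sgn(R,S)` defined by `e^{[R,S]} = sgn(R,S) e^R ∧ e^S` for disjoint
increasing multi-indices: `(-1)` to the number of inversions between `R` and `S`. -/
def msign {n : ℕ} (R S : Finset (Fin n)) : ℝ :=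
  (-1 : ℝ) ^ (((R ×ˢ S).filter (fun p => p.2 < p.1)).card)

/-- The basis form `e^S` (of degree `k = S.card`; zero if `k ≠ S.card`). -/
def bform {n k : ℕ} (S : Finset (Fin n)) : Lam n k :=
  fun I => if I.1 = S then 1 else 0

/-- Exterior (wedge) product in coordinates.  When `m = k + l` this is the wedge
product `Λᵏ × Λˡ → Λ^{k+l}`; for other `m` it is `0`. -/
def wedge {n k l m : ℕ} (ω : Lam n k) (φ : Lam n l) : Lam n m :=
  fun I => ∑ R : Idx n k, ∑ S : Idx n l,
    if R.1 ∪ S.1 = I.1 ∧ Disjoint R.1 S.1 then msign R.1 S.1 * (ω R * φ S) else 0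

/-- Interior product `a ⌟ b`, characterized by `⟨a ⌟ b; c⟩ = ⟨b; a ∧ c⟩`.  When
`m = k - j` this is the interior product `Λʲ × Λᵏ → Λ^{k-j}`; for other `m` it is `0`. -/
def iprod {n j k m : ℕ} (a : Lam n j) (b : Lam n k) : Lam n m :=
  fun C => ∑ A : Idx n j, ∑ B : Idx n k,
    if A.1 ∪ C.1 = B.1 ∧ Disjoint A.1 C.1 then msign A.1 C.1 * (a A * b B) else 0

/-- Hodge star with respect to the standard orientation; when `m = n - k` this is
`∗ : Λᵏ → Λ^{n-k}`. -/
def hstar {n k m : ℕ} (ω : Lam n k) : Lam n m :=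
  fun J => ∑ I : Idx n k, if I.1 = (J.1)ᶜ then msign I.1 J.1 * ω I else 0

/-- Inner product `⟨·;·⟩` on `Λᵏ` (the basis `e^I` is orthonormal). -/
def ip {n k : ℕ} (ω α : Lam n k) : ℝ := ∑ I : Idx n k, ω I * α I

/-- `s`-fold exterior power `ω^s = ω ∧ ⋯ ∧ ω` (with `ω^0 = 1 ∈ Λ⁰`). -/
def lpow {n k : ℕ} (ω : Lam n k) : (s : ℕ) → Lam n (k * s)
  | 0 => bform ∅
  | s + 1 => wedge ω (lpow ω s)

/-- `f : Λᵏ → ℝ` is ext. one convex. -/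
def ExtOneConvex {n k : ℕ} (f : Lam n k → ℝ) : Prop :=
  ∀ (ω : Lam n k) (a : Lam n 1) (b : Lam n (k-1)),
    ConvexOn ℝ Set.univ (fun t : ℝ => f (ω + t • (wedge a b : Lam n k)))

/-- `f : Λᵏ → ℝ` is ext. one affine. -/
def ExtOneAffine {n k : ℕ} (f : Lam n k → ℝ) : Prop :=
  ExtOneConvex f ∧ ExtOneConvex (fun ω => -f ω)

/-- `f : Λᵏ → ℝ` is int. one convex. -/
def IntOneConvex {n k : ℕ} (f : Lam n k → ℝ) : Prop :=
  ∀ (ω : Lam n k) (a : Lam n 1) (b : Lam n (k+1)),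
    ConvexOn ℝ Set.univ (fun t : ℝ => f (ω + t • (iprod a b : Lam n k)))

/-- `f : Λᵏ → ℝ` is int. one affine. -/
def IntOneAffine {n k : ℕ} (f : Lam n k → ℝ) : Prop :=
  IntOneConvex f ∧ IntOneConvex (fun ω => -f ω)

/-- `f : Λ^{k+1} × Λ^{k-1} → ℝ` is ext-int. one convex. -/
def ExtIntOneConvex {n k : ℕ} (f : Lam n (k+1) → Lam n (k-1) → ℝ) : Prop :=
  ∀ (ξ : Lam n (k+1)) (η : Lam n (k-1)) (a : Lam n 1) (b : Lam n k),
    ConvexOn ℝ Set.univ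
      (fun t : ℝ => f (ξ + t • (wedge a b : Lam n (k+1))) (η + t • (iprod a b : Lam n (k-1))))

/-- `f : Λ^{k+1} × Λ^{k-1} → ℝ` is ext-int. one affine. -/
def ExtIntOneAffine {n k : ℕ} (f : Lam n (k+1) → Lam n (k-1) → ℝ) : Prop :=
  ExtIntOneConvex f ∧ ExtIntOneConvex (fun ξ η => -f ξ η)

/-- `g : Λᵏ → ℝ` is affine, i.e. a constant plus a linear functional. -/
def AffineFn {n k : ℕ} (g : Lam n k → ℝ) : Prop :=
  ∃ (c : ℝ) (a : Lam n k), ∀ ω, g ω = c + ip a ω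

/-- The matrix of `b ↦ a ∧ b` from `Λᵏ` to `Λᵐ`; its transpose represents `u ↦ a ⌟ u`. -/
def wedgeMatrix {n j : ℕ} (k m : ℕ) (a : Lam n j) : Matrix (Idx n m) (Idx n k) ℝ :=
  fun I S => ∑ R : Idx n j,
    if R.1 ∪ S.1 = I.1 ∧ Disjoint R.1 S.1 then msign R.1 S.1 * a R else 0

theorem wedge_eq_mulVec {n j k m : ℕ} (a : Lam n j) (b : Lam n k) :
    (wedge a b : Lam n m) = (wedgeMatrix k m a).mulVec b := by
  funext I
  simp only [wedge, wedgeMatrix, Matrix.mulVec, dotProduct, Finset.sum_mul]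
  rw [Finset.sum_comm]
  simp only [ite_mul, zero_mul, mul_assoc]

theorem iprod_eq_mulVec {n j k m : ℕ} (a : Lam n j) (u : Lam n m) :
    (iprod a u : Lam n k) = (wedgeMatrix k m a).transpose.mulVec u := by
  funext C
  simp only [iprod, wedgeMatrix, Matrix.mulVec, dotProduct, Finset.sum_mul, Matrix.transpose_apply]
  rw [Finset.sum_comm]
  simp only [ite_mul, zero_mul, mul_assoc]

/-- Extension of a form to all finite index sets, by zero outside its degree. -/
def Lam.extend {n k : ℕ} (b : Lam n k) (S : Finset (Fin n)) : ℝ :=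
  if h : S.card = k then b ⟨S, h⟩ else 0

theorem sum_idx_one {n : ℕ} (g : Idx n 1 → ℝ) :
    ∑ A : Idx n 1, g A = ∑ i : Fin n, g ⟨{i}, Finset.card_singleton i⟩ := by
  symm
  refine Fintype.sum_bijective (fun i : Fin n => (⟨{i}, Finset.card_singleton i⟩ : Idx n 1))
    ⟨fun i j h => ?_, fun A => ?_⟩ _ _ fun _ => rfl
  · simpa using h
  · obtain ⟨i, hi⟩ := Finset.card_eq_one.mp A.2
    exact ⟨i, Subtype.ext hi.symm⟩

theorem iprod_one_apply {n k m : ℕ} (a : Lam n 1) (b : Lam n k) (C : Idx n m) :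
    (iprod a b : Lam n m) C = ∑ i : Fin n, if i ∉ C.1 then
      msign {i} C.1 * (a ⟨{i}, Finset.card_singleton i⟩ * b.extend (insert i C.1)) else 0 := by
  rw [iprod, sum_idx_one]
  refine Finset.sum_congr rfl fun i _ => ?_
  by_cases hi : i ∈ C.1
  · simp [hi]
  · by_cases hc : (insert i C.1).card = k
    · rw [Finset.sum_eq_single (⟨insert i C.1, hc⟩ : Idx n k)]
      · simp [hi, Lam.extend, hc]
      · intro B _ hB
        refine if_neg fun h => hB (Subtype.ext ?_)
        exact h.1.symm.trans (Finset.insert_eq i C.1).symm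
      · simp
    · rw [Finset.sum_eq_zero]
      · simp [Lam.extend, hc]
      · intro B _
        refine if_neg fun h => hc ?_
        rw [Finset.insert_eq, h.1, B.2]

theorem msign_singleton {n : ℕ} (i : Fin n) (C : Finset (Fin n)) :
    msign {i} C = (-1) ^ (C.filter (· < i)).card := by
  unfold msign
  congr 1
  refine Finset.card_bij' (fun p _ => p.2) (fun c _ => (i, c)) ?_ ?_ ?_ ?_ <;>
    simp +contextual [Prod.ext_iff]

theorem msign_singleton_insert {n : ℕ} {i : Fin n} (j : Fin n) {C : Finset (Fin n)}
    (hi : i ∉ C) : msign {j} (insert i C) = (if i < j then -1 else 1) * msign {j} C := by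
  rw [msign_singleton, msign_singleton, Finset.filter_insert]
  split_ifs
  · rw [Finset.card_insert_of_notMem (by simp [hi]), pow_succ]
    ring
  · simp

theorem iprod_iprod_self {n m : ℕ} (a : Lam n 1) (u : Lam n (m + 2)) :
    (iprod a (iprod a u : Lam n (m + 1)) : Lam n m) = 0 := by
  funext C
  have expand : (iprod a (iprod a u : Lam n (m + 1)) : Lam n m) C =
      ∑ i : Fin n, ∑ j : Fin n, if i ∉ C.1 ∧ j ∉ C.1 ∧ i ≠ j then
        (if i < j then -1 else 1) * (msign {i} C.1 * msign {j} C.1 *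
          (a ⟨{i}, Finset.card_singleton i⟩ * a ⟨{j}, Finset.card_singleton j⟩ *
            u.extend (insert j (insert i C.1)))) else 0 := by
    rw [iprod_one_apply]
    refine Finset.sum_congr rfl fun i _ => ?_
    by_cases hi : i ∈ C.1
    · simp [hi]
    · have hc : (insert i C.1).card = m + 1 := by
        rw [Finset.card_insert_of_notMem hi, C.2]
      rw [if_pos hi, Lam.extend, dif_pos hc, iprod_one_apply, Finset.mul_sum, Finset.mul_sum]
      refine Finset.sum_congr rfl fun j _ => ?_
      by_cases hj : j ∈ C.1
      · simp [hj]
      · by_cases hij : i = j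
        · simp [hij]
        · have hji : j ∉ insert i C.1 := by simp [hj, Ne.symm hij]
          rw [if_pos hji, if_pos ⟨hi, hj, hij⟩, msign_singleton_insert j hi]
          ring
  have swap : (iprod a (iprod a u : Lam n (m + 1)) : Lam n m) C =
      -(iprod a (iprod a u : Lam n (m + 1)) : Lam n m) C := by
    conv_lhs => rw [expand, Finset.sum_comm]
    rw [expand, ← Finset.sum_neg_distrib]
    refine Finset.sum_congr rfl fun i _ => ?_
    rw [← Finset.sum_neg_distrib]
    refine Finset.sum_congr rfl fun j _ => ?_
    by_cases h : i ∉ C.1 ∧ j ∉ C.1 ∧ i ≠ j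
    · rw [if_pos h, if_pos ⟨h.2.1, h.1, h.2.2.symm⟩, Finset.insert_comm i j]
      rcases lt_or_gt_of_ne h.2.2 with hij | hij
      · rw [if_neg hij.not_gt, if_pos hij]
        ring
      · rw [if_pos hij, if_neg hij.not_gt]
        ring
    · rw [if_neg h, if_neg fun h' => h ⟨h'.2.1, h'.1, h'.2.2.symm⟩, neg_zero]
  simp only [Pi.zero_apply]
  linarith

/-- The normal equations `A Aᵀ u = A b` are always solvable. -/
theorem exists_mul_transpose_mulVec_eq {ι κ : Type*} [Fintype ι] [Fintype κ]
    (A : Matrix ι κ ℝ) (b : κ → ℝ) :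
    ∃ u : ι → ℝ, A.mulVec (A.transpose.mulVec u) = A.mulVec b := by
  have hle : LinearMap.range (A * A.transpose).mulVecLin ≤ LinearMap.range A.mulVecLin := by
    rw [Matrix.mulVecLin_mul]
    exact LinearMap.range_comp_le_range _ _
  have heq := Submodule.eq_of_le_of_finrank_eq hle (Matrix.rank_self_mul_transpose A)
  have hb : A.mulVecLin b ∈ LinearMap.range (A * A.transpose).mulVecLin :=
    heq ▸ LinearMap.mem_range_self _ b
  obtain ⟨u, hu⟩ := hb
  exact ⟨u, (Matrix.mulVec_mulVec u A A.transpose).trans hu⟩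

/-- Every `a ⌟ b` is of the form `a ⌟ b'` with `a ∧ b' = 0`: since the orthogonal complement of
the kernel of `a ∧ ·` is the range of `a ⌟ ·`, on which `a ⌟ ·` vanishes, `b'` may be taken as
the projection of `b` on that kernel. -/
theorem exists_wedge_eq_zero_iprod_eq {n m : ℕ} (a : Lam n 1) (b : Lam n (m + 1)) :
    ∃ b' : Lam n (m + 1), (wedge a b' : Lam n (m + 2)) = 0 ∧
      (iprod a b' : Lam n m) = iprod a b := by
  obtain ⟨u, hu⟩ := exists_mul_transpose_mulVec_eq (wedgeMatrix (m + 1) (m + 2) a) b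
  rw [← iprod_eq_mulVec] at hu
  refine ⟨b - iprod a u, ?_, ?_⟩
  · rw [wedge_eq_mulVec, Matrix.mulVec_sub, hu, sub_self]
  · have h := iprod_iprod_self a u
    rw [iprod_eq_mulVec a (iprod a u)] at h
    rw [iprod_eq_mulVec, Matrix.mulVec_sub, h, sub_zero, iprod_eq_mulVec]

theorem ExtIntOneConvex.intOneConvex {n k : ℕ} (hk : 1 ≤ k)
    {f : Lam n (k+1) → Lam n (k-1) → ℝ} (hf : ExtIntOneConvex f) (ξ : Lam n (k+1)) :
    IntOneConvex (fun η => f ξ η) := by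
  obtain ⟨m, rfl⟩ := Nat.exists_eq_add_of_le' hk
  intro η a b
  obtain ⟨b', hw, hi⟩ := exists_wedge_eq_zero_iprod_eq (m := m) a b
  have h := hf ξ η a b'
  simp only [hw, smul_zero, add_zero] at h
  rw [← hi]
  exact h

/-- **Lemma.** Let `1 ≤ k ≤ n-1` and let `f : Λ^{k+1} × Λ^{k-1} → ℝ` be
ext-int. one convex (resp. ext-int. one affine).  Then for every `ξ ∈ Λ^{k+1}`,
the function `η ↦ f(ξ,η)` is int. one convex (resp. int. one affine). -/
theorem stmt8 {n k : ℕ} (hk : 1 ≤ k) (hkn : k ≤ n - 1)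
    (f : Lam n (k+1) → Lam n (k-1) → ℝ) :
    (ExtIntOneConvex f → ∀ ξ : Lam n (k+1), IntOneConvex (fun η => f ξ η)) ∧
    (ExtIntOneAffine f → ∀ ξ : Lam n (k+1), IntOneAffine (fun η => f ξ η)) := by
  exact ⟨fun hf ξ => hf.intOneConvex hk ξ,
    fun hf ξ => ⟨hf.1.intOneConvex hk ξ, hf.2.intOneConvex hk ξ⟩⟩
end

section
/- Let 0 ≤ k ≤ n−1 and let f : Λ^k → ℝ. Then f is int. one convex if and only if its Hodge transform f_∗ : Λ^{n−k} → ℝ, defined by f_∗(ω) := f(∗ω), is ext. one convex. Similarly, for 1 ≤ k ≤ n, f : Λ^k → ℝ is ext. one convex if and only if f_∗ is int. one convex. -/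
theorem msign_union_left {n : ℕ} {R S : Finset (Fin n)} (h : Disjoint R S)
    (T : Finset (Fin n)) : msign (R ∪ S) T = msign R T * msign S T := by
  unfold msign
  rw [← pow_add, Finset.union_product, Finset.filter_union, Finset.card_union_of_disjoint]
  exact Finset.disjoint_filter_filter (Finset.disjoint_product.2 (Or.inl h))

theorem msign_mul_self {n : ℕ} (R S : Finset (Fin n)) : msign R S * msign R S = 1 := by
  unfold msign
  rw [← mul_pow]
  simp

theorem msign_mul_msign_swap {n : ℕ} {R S : Finset (Fin n)} (h : Disjoint R S) :
    msign R S * msign S R = (-1) ^ (R.card * S.card) := by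
  unfold msign
  rw [← pow_add, ← Finset.card_product,
    ← Finset.card_filter_add_card_filter_not (s := R ×ˢ S) (fun p => p.2 < p.1)]
  congr 2
  refine Finset.card_bij (fun p _ => (p.2, p.1)) ?_ ?_ ?_
  · rintro ⟨x, y⟩ hp
    simp only [Finset.mem_filter, Finset.mem_product] at hp ⊢
    exact ⟨⟨hp.1.2, hp.1.1⟩, hp.2.not_gt⟩
  · rintro ⟨x, y⟩ - ⟨z, w⟩ - hp
    simpa [and_comm] using hp
  · rintro ⟨x, y⟩ hp
    simp only [Finset.mem_filter, Finset.mem_product, not_lt] at hp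
    refine ⟨(y, x), ?_, rfl⟩
    simp only [Finset.mem_filter, Finset.mem_product]
    exact ⟨⟨hp.1.2, hp.1.1⟩, lt_of_le_of_ne hp.2 (Finset.disjoint_left.1 h hp.1.1 <| · ▸ hp.1.2)⟩

/-- Complementation of multi-indices. -/
def Idx.compl {n k m : ℕ} (h : k + m = n) : Idx n k ≃ Idx n m where
  toFun I := ⟨I.1ᶜ, by rw [Finset.card_compl, I.2, Fintype.card_fin]; omega⟩
  invFun J := ⟨J.1ᶜ, by rw [Finset.card_compl, J.2, Fintype.card_fin]; omega⟩
  left_inv I := by simp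
  right_inv J := by simp

theorem hstar_apply {n k m : ℕ} (h : k + m = n) (ω : Lam n k) (J : Idx n m) :
    hstar ω J = msign J.1ᶜ J.1 * ω ((Idx.compl h).symm J) := by
  unfold hstar
  rw [Finset.sum_eq_single ((Idx.compl h).symm J)]
  · exact if_pos rfl
  · exact fun I _ hI => if_neg fun e => hI (Subtype.ext e)
  · simp

theorem hstar_add {n k m : ℕ} (ω φ : Lam n k) :
    (hstar (ω + φ) : Lam n m) = hstar ω + hstar φ := by
  ext J
  simp only [hstar, Pi.add_apply, ← Finset.sum_add_distrib]
  refine Finset.sum_congr rfl fun I _ => ?_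
  split_ifs <;> ring

theorem hstar_smul {n k m : ℕ} (c : ℝ) (ω : Lam n k) :
    (hstar (c • ω) : Lam n m) = c • hstar ω := by
  ext J
  simp only [hstar, Pi.smul_apply, smul_eq_mul, Finset.mul_sum]
  refine Finset.sum_congr rfl fun I _ => ?_
  split_ifs <;> ring

theorem wedge_smul_right {n k l m : ℕ} (c : ℝ) (ω : Lam n k) (φ : Lam n l) :
    (wedge ω (c • φ) : Lam n m) = c • wedge ω φ := by
  ext I
  simp only [wedge, Pi.smul_apply, smul_eq_mul, Finset.mul_sum]
  refine Finset.sum_congr rfl fun R _ => Finset.sum_congr rfl fun S _ => ?_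
  split_ifs <;> ring

theorem iprod_smul_right {n j k m : ℕ} (c : ℝ) (a : Lam n j) (b : Lam n k) :
    (iprod a (c • b) : Lam n m) = c • iprod a b := by
  ext I
  simp only [iprod, Pi.smul_apply, smul_eq_mul, Finset.mul_sum]
  refine Finset.sum_congr rfl fun R _ => Finset.sum_congr rfl fun S _ => ?_
  split_ifs <;> ring

theorem hstar_hstar {n k m : ℕ} (h : k + m = n) (ω : Lam n k) :
    (hstar (hstar ω : Lam n m) : Lam n k) = (-1 : ℝ) ^ (k * m) • ω := by
  ext J
  rw [hstar_apply (by omega : m + k = n), hstar_apply h]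
  have hs := msign_mul_msign_swap (disjoint_compl_left : Disjoint J.1ᶜ J.1)
  rw [Finset.card_compl, J.2, Fintype.card_fin, show n - k = m by omega] at hs
  have hJ : (Idx.compl h).symm ((Idx.compl (by omega : m + k = n)).symm J) = J :=
    Subtype.ext (compl_compl J.1)
  rw [hJ, Pi.smul_apply, smul_eq_mul, mul_comm k m, ← hs, mul_assoc]
  simp [Idx.compl]

/-- The interior product is, up to sign, the Hodge conjugate of the exterior product. -/
theorem iprod_eq_hstar_wedge_hstar {n j k l m p : ℕ} (hp : p + l = n) (hm : m + k = n)
    (a : Lam n j) (b : Lam n p) :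
    (iprod a b : Lam n k) =
      (-1 : ℝ) ^ (l * k) • hstar (wedge a (hstar b : Lam n l) : Lam n m) := by
  ext C
  rw [Pi.smul_apply, hstar_apply hm, smul_eq_mul]
  unfold iprod wedge
  simp only [Finset.mul_sum]
  refine Finset.sum_congr rfl fun A _ => ?_
  refine Fintype.sum_equiv (Idx.compl hp) _ _ fun B => ?_
  have hiff : (A.1 ∪ C.1 = B.1 ∧ Disjoint A.1 C.1) ↔
      (A.1 ∪ B.1ᶜ = C.1ᶜ ∧ Disjoint A.1 B.1ᶜ) := by
    simp only [Finset.ext_iff, Finset.disjoint_left, Finset.mem_union, Finset.mem_compl,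
      ← forall_and]
    exact forall_congr' fun x => by tauto
  change _ = _ * (_ * if A.1 ∪ B.1ᶜ = C.1ᶜ ∧ Disjoint A.1 B.1ᶜ then
    msign A.1 B.1ᶜ * (a A * hstar b (Idx.compl hp B)) else 0)
  by_cases hc : A.1 ∪ C.1 = B.1 ∧ Disjoint A.1 C.1
  · have hc' := hiff.1 hc
    rw [if_pos hc, if_pos hc', hstar_apply hp, Equiv.symm_apply_apply]
    change _ = _ * (_ * (_ * (_ * (msign B.1ᶜᶜ B.1ᶜ * _))))
    have hCB : Disjoint B.1ᶜ C.1 := by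
      rw [← hc.1]
      exact disjoint_compl_left.mono_right Finset.subset_union_right
    have hs := msign_mul_msign_swap hCB
    rw [C.2, show B.1ᶜ.card = l from (Idx.compl hp B).2] at hs
    have h₁ := msign_union_left hc'.2 C.1
    have h₂ := msign_union_left hc.2 B.1ᶜ
    rw [hc'.1] at h₁
    rw [hc.1] at h₂
    rw [compl_compl, h₁, h₂, ← hs]
    linear_combination (-(msign A.1 C.1 * a A * b B)) *
      (msign_mul_self B.1ᶜ C.1 * (msign C.1 B.1ᶜ ^ 2 * msign A.1 B.1ᶜ ^ 2) +
        msign_mul_self C.1 B.1ᶜ * msign A.1 B.1ᶜ ^ 2 + msign_mul_self A.1 B.1ᶜ)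
  · rw [if_neg hc, if_neg (hiff.not.1 hc)]
    simp

theorem neg_one_pow_mul_self (e : ℕ) : (-1 : ℝ) ^ e * (-1) ^ e = 1 := by
  rw [← mul_pow]
  simp

theorem intOneConvex_iff_extOneConvex_hstar {n k l : ℕ} (h : k + (l + 1) = n)
    (f : Lam n k → ℝ) :
    IntOneConvex f ↔ ExtOneConvex (fun ω : Lam n (l + 1) => f (hstar ω)) := by
  have key (a : Lam n 1) (b : Lam n (k + 1)) := iprod_eq_hstar_wedge_hstar
    (by omega : k + 1 + l = n) (by omega : l + 1 + k = n) a b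
  constructor
  · intro hf ω a b
    change Lam n l at b
    have hb : (hstar (wedge a b : Lam n (l + 1)) : Lam n k) =
        iprod a (((-1 : ℝ) ^ (l * k) * (-1) ^ (l * (k + 1))) • (hstar b : Lam n (k + 1))) := by
      rw [iprod_smul_right, key, hstar_hstar (by omega : l + (k + 1) = n), wedge_smul_right,
        hstar_smul, smul_smul, smul_smul]
      rw [show ∀ x y : ℝ, x * y * x * y = (x * x) * (y * y) by intros; ring,
        neg_one_pow_mul_self, neg_one_pow_mul_self, one_mul, one_smul]
    simp only [hstar_add, hstar_smul]
    exact hb ▸ hf _ _ _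
  · intro hf ω a b
    have hω : ω = hstar ((-1 : ℝ) ^ (k * (l + 1)) • (hstar ω : Lam n (l + 1))) := by
      rw [hstar_smul, hstar_hstar h, smul_smul, neg_one_pow_mul_self, one_smul]
    have := hf ((-1 : ℝ) ^ (k * (l + 1)) • (hstar ω : Lam n (l + 1))) a
      ((-1 : ℝ) ^ (l * k) • (hstar b : Lam n l))
    simp only [hstar_add, hstar_smul, wedge_smul_right] at this
    rw [key]
    rw [hstar_smul] at hω
    rwa [← hω] at this

theorem ExtOneConvex.comp_smul {n k : ℕ} {f : Lam n k → ℝ} (hf : ExtOneConvex f) (c : ℝ) :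
    ExtOneConvex (fun ω => f (c • ω)) := by
  intro ω a b
  have := hf (c • ω) a (c • b)
  simp only [wedge_smul_right] at this
  simpa only [smul_add, smul_comm c] using this

theorem extOneConvex_iff_intOneConvex_hstar {n k m : ℕ} (hk : 1 ≤ k) (h : k + m = n)
    (f : Lam n k → ℝ) :
    ExtOneConvex f ↔ IntOneConvex (fun ω : Lam n m => f (hstar ω)) := by
  obtain ⟨l, rfl⟩ := Nat.exists_eq_add_of_le' hk
  rw [intOneConvex_iff_extOneConvex_hstar (by omega : m + (l + 1) = n)]
  simp only [hstar_hstar h]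
  refine ⟨fun hf => hf.comp_smul _, fun hf => ?_⟩
  simpa only [smul_smul, neg_one_pow_mul_self, one_smul] using
    hf.comp_smul ((-1 : ℝ) ^ ((l + 1) * m))

/-- **Hodge transform duality.** For `0 ≤ k ≤ n-1`, `f : Λᵏ → ℝ` is int. one convex iff
its Hodge transform `f_∗ : Λ^{n-k} → ℝ`, `f_∗(ω) = f(∗ω)`, is ext. one convex; and for
`1 ≤ k ≤ n`, `f : Λᵏ → ℝ` is ext. one convex iff `f_∗` is int. one convex. -/
theorem stmt10 {n : ℕ} :
    (∀ k : ℕ, k ≤ n - 1 → ∀ f : Lam n k → ℝ,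
      (IntOneConvex f ↔ ExtOneConvex (fun ω : Lam n (n-k) => f (hstar ω)))) ∧
    (∀ k : ℕ, 1 ≤ k → k ≤ n → ∀ f : Lam n k → ℝ,
      (ExtOneConvex f ↔ IntOneConvex (fun ω : Lam n (n-k) => f (hstar ω)))) := by
  refine ⟨fun k hk f => ?_, fun k hk hkn f => extOneConvex_iff_intOneConvex_hstar hk (by omega) f⟩
  rcases Nat.eq_zero_or_pos n with rfl | hn
  · have : IsEmpty (Idx 0 1) :=
      ⟨fun A => by simpa [Finset.eq_empty_of_isEmpty A.1] using A.2⟩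
    constructor
    · intro _ ω a b
      have hw : (wedge a b : Lam 0 (0 - k)) = 0 := by ext; simp [wedge]
      simpa only [hw, smul_zero, add_zero] using convexOn_const _ convex_univ
    · intro _ ω a b
      have hw : (iprod a b : Lam 0 k) = 0 := by ext; simp [iprod]
      simpa only [hw, smul_zero, add_zero] using convexOn_const _ convex_univ
  · obtain ⟨l, hl⟩ : ∃ l, n - k = l + 1 := ⟨n - k - 1, by omega⟩
    rw [hl]
    exact intOneConvex_iff_extOneConvex_hstar (by omega) f
end
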